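/- arXiv:1510.07294 — 2 statements merged into one kernel-verified Lean document; each statement's English description precedes it below -/
import Mathlib

section
/- Let K be a norm on ℝ^n, let Y ∈ ℝ^n, let σ̂ ≥ 0, and let μ̂ be a minimizer of K(ν) over the set {ν ∈ ℝ^n : ‖Y − ν‖² ≤ n σ̂²}. If μ̂ ≠ 0, then ‖Y − μ̂‖² = n σ̂², and every ν ∈ ℝ^n with K(ν) ≤ K(μ̂) satisfies ‖Y − ν‖² ≥ n σ̂²; in particular, μ̂ is the Euclidean projection of Y onto the K-ball {ν : K(ν) ≤ K(μ̂)}. -/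
theorem stmt12 {n : ℕ}
    (K : EuclideanSpace ℝ (Fin n) → ℝ)
    (hK_add : ∀ x y, K (x + y) ≤ K x + K y)
    (hK_smul : ∀ (c : ℝ) (x : EuclideanSpace ℝ (Fin n)), K (c • x) = |c| * K x)
    (hK_zero : ∀ x, K x = 0 ↔ x = 0)
    (Y : EuclideanSpace ℝ (Fin n)) (σhat : ℝ) (hσhat : 0 ≤ σhat)
    (μhat : EuclideanSpace ℝ (Fin n))
    (hfeas : ‖Y - μhat‖ ^ 2 ≤ n * σhat ^ 2)
    (hmin : ∀ ν : EuclideanSpace ℝ (Fin n), ‖Y - ν‖ ^ 2 ≤ n * σhat ^ 2 → K μhat ≤ K ν)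
    (hne : μhat ≠ 0) :
    ‖Y - μhat‖ ^ 2 = n * σhat ^ 2 ∧
      (∀ ν : EuclideanSpace ℝ (Fin n), K ν ≤ K μhat → n * σhat ^ 2 ≤ ‖Y - ν‖ ^ 2) ∧
      (∀ ν : EuclideanSpace ℝ (Fin n), K ν ≤ K μhat → ‖Y - μhat‖ ≤ ‖Y - ν‖) := by
  have hpos : 0 < K μhat := by
    have h1 := hK_add μhat ((-1 : ℝ) • μhat)
    have h2 : μhat + (-1 : ℝ) • μhat = 0 := by simp
    rw [h2, (hK_zero 0).2 rfl, hK_smul] at h1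
    have h3 : K μhat ≠ 0 := fun h => hne ((hK_zero _).1 h)
    have h4 : 0 ≤ K μhat := by
      norm_num at h1
      linarith
    exact lt_of_le_of_ne h4 (Ne.symm h3)
  have key : ∀ ν : EuclideanSpace ℝ (Fin n), K ν ≤ K μhat → n * σhat ^ 2 ≤ ‖Y - ν‖ ^ 2 := by
    intro ν hν
    by_contra hlt
    rw [not_le] at hlt
    have hc : Continuous (fun t : ℝ => ‖Y - t • ν‖ ^ 2) := by fun_prop
    have he : ∀ᶠ t in nhds (1 : ℝ), ‖Y - t • ν‖ ^ 2 < n * σhat ^ 2 := by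
      refine hc.continuousAt.eventually_lt continuousAt_const ?_
      simpa using hlt
    have he2 : ∀ᶠ t in nhds (1 : ℝ), 0 < t := lt_mem_nhds one_pos
    have he3 : ∀ᶠ t in nhdsWithin (1 : ℝ) (Set.Iio 1), t < 1 := self_mem_nhdsWithin
    obtain ⟨t, ⟨ht1, ht2⟩, ht3⟩ := (((he.and he2).filter_mono nhdsWithin_le_nhds).and he3).exists
    have h := hmin (t • ν) ht1.le
    rw [hK_smul, abs_of_pos ht2] at h
    nlinarith [mul_le_mul_of_nonneg_left hν ht2.le]
  have heq := le_antisymm hfeas (key μhat le_rfl)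
  refine ⟨heq, key, fun ν hν => ?_⟩
  have h := key ν hν
  rw [← heq] at h
  exact (sq_le_sq₀ (norm_nonneg _) (norm_nonneg _)).1 h
end

section
/- Let K be a norm on ℝ^n, Y ∈ ℝ^n, σ̂ ≥ 0, and let μ̂ be a minimizer of K(ν) over {ν ∈ ℝ^n : ‖Y − ν‖² ≤ n σ̂²}. For L ≥ 0, let μ̂_L be the Euclidean projection of Y onto the K-ball {ν : K(ν) ≤ L} and set σ̂_L² := ‖Y − μ̂_L‖²/n. Then for every L ≥ 0, ‖μ̂_L − μ̂‖²/n ≤ |σ̂_L² − σ̂²|. -/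
theorem aux_real (R A B C : ℝ) (hC : 0 ≤ C) (hA : A ≤ R)
    (h : ∀ t : ℝ, 0 < t → t ≤ 1 → R ≤ A - 2 * t * B + t ^ 2 * C) : R = A ∧ B ≤ 0 := by
  have h1 : R = A := by
    by_contra hne
    have hd : 0 < R - A := sub_pos.mpr (lt_of_le_of_ne hA (Ne.symm hne))
    have hB := abs_nonneg B
    have hs : 0 < (R - A) + (2 * |B| + C) := by linarith
    set t := (R - A) / ((R - A) + (2 * |B| + C)) with ht
    have t0 : 0 < t := div_pos hd hs
    have t1 : t ≤ 1 := by rw [ht, div_le_one hs]; linarith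
    have hh := h t t0 t1
    have e : t * ((R - A) + (2 * |B| + C)) = R - A := by rw [ht]; field_simp
    have f1 : - B ≤ |B| := neg_le_abs B
    have f2 : t * (-B) ≤ t * |B| := mul_le_mul_of_nonneg_left f1 t0.le
    have f3 : t ^ 2 * C ≤ t * C := by
      apply mul_le_mul_of_nonneg_right _ hC
      nlinarith
    have f4 : 0 < t * (R - A) := mul_pos t0 hd
    nlinarith
  refine ⟨h1, ?_⟩
  by_contra hB
  push Not at hB
  have hs : 0 < B + C := by linarith
  set t := B / (B + C) with ht
  have t0 : 0 < t := div_pos hB hs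
  have t1 : t ≤ 1 := by rw [ht, div_le_one hs]; linarith
  have hh := h t t0 t1
  have e : t * (B + C) = B := by rw [ht]; field_simp
  have f : 0 ≤ t * (t * C - 2 * B) := by nlinarith
  have g : 0 ≤ t * C - 2 * B := nonneg_of_mul_nonneg_right f t0
  nlinarith [mul_pos t0 hB]

theorem aux_vec {E : Type*} [NormedAddCommGroup E] [InnerProductSpace ℝ E] (R : ℝ) (p q : E)
    (hA : ‖p‖ ^ 2 ≤ R)
    (h : ∀ t : ℝ, 0 < t → t ≤ 1 → R ≤ ‖p - t • q‖ ^ 2) : R + ‖q‖ ^ 2 ≤ ‖p - q‖ ^ 2 := by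
  have := aux_real R (‖p‖ ^ 2) (inner ℝ p q) (‖q‖ ^ 2) (by positivity) hA (by
    intro t t0 t1
    have := h t t0 t1
    rw [norm_sub_sq_real, inner_smul_right, norm_smul, mul_pow, Real.norm_eq_abs, sq_abs] at this
    linarith)
  rw [norm_sub_sq_real]
  linarith [this.1, this.2]

theorem stmt13 {n : ℕ}
    (K : EuclideanSpace ℝ (Fin n) → ℝ)
    (hK_add : ∀ x y, K (x + y) ≤ K x + K y)
    (hK_smul : ∀ (c : ℝ) (x : EuclideanSpace ℝ (Fin n)), K (c • x) = |c| * K x)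
    (hK_zero : ∀ x, K x = 0 ↔ x = 0)
    (Y : EuclideanSpace ℝ (Fin n)) (σhat : ℝ) (hσhat : 0 ≤ σhat)
    (μhat : EuclideanSpace ℝ (Fin n))
    (hfeas : ‖Y - μhat‖ ^ 2 ≤ n * σhat ^ 2)
    (hmin : ∀ ν : EuclideanSpace ℝ (Fin n), ‖Y - ν‖ ^ 2 ≤ n * σhat ^ 2 → K μhat ≤ K ν)
    (μhatL : ℝ → EuclideanSpace ℝ (Fin n))
    (hproj : ∀ L, 0 ≤ L → K (μhatL L) ≤ L ∧
      ∀ ν : EuclideanSpace ℝ (Fin n), K ν ≤ L → ‖Y - μhatL L‖ ≤ ‖Y - ν‖) :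
    ∀ L, 0 ≤ L → ‖μhatL L - μhat‖ ^ 2 / n ≤ |‖Y - μhatL L‖ ^ 2 / n - σhat ^ 2| := by
  intro L hL
  rcases Nat.eq_zero_or_pos n with hn | hn
  · subst hn
    simp
    positivity
  have hn' : (0 : ℝ) < n := by exact_mod_cast hn
  obtain ⟨hb, hbp⟩ := hproj L hL
  generalize μhatL L = b at hb hbp
  have hconv : ∀ (x y : EuclideanSpace ℝ (Fin n)) (t : ℝ), 0 < t → t ≤ 1 →
      K (x + t • (y - x)) ≤ (1 - t) * K x + t * K y := by
    intro x y t t0 t1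
    have e : x + t • (y - x) = (1 - t) • x + t • y := by module
    rw [e]
    refine (hK_add _ _).trans ?_
    rw [hK_smul, hK_smul, abs_of_nonneg (sub_nonneg.mpr t1), abs_of_pos t0]
  have key : ‖b - μhat‖ ^ 2 ≤ |‖Y - b‖ ^ 2 - n * σhat ^ 2| := by
    rcases le_or_gt (K μhat) L with hc | hc
    · have := aux_vec (‖Y - b‖ ^ 2) (Y - b) (μhat - b) le_rfl (by
        intro t t0 t1
        have h1 : K (b + t • (μhat - b)) ≤ L := by
          refine (hconv _ _ t t0 t1).trans ?_
          nlinarith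
        have h2 := hbp _ h1
        rw [sub_sub]
        gcongr)
      rw [sub_sub_sub_cancel_right, norm_sub_rev μhat b] at this
      rw [abs_sub_comm]
      exact le_trans (by linarith) (le_abs_self _)
    · have := aux_vec (n * σhat ^ 2) (Y - μhat) (b - μhat) hfeas (by
        intro t t0 t1
        by_contra hlt
        push Not at hlt
        rw [sub_sub] at hlt
        have h1 := hmin _ hlt.le
        have h2 := hconv μhat b t t0 t1
        nlinarith)
      rw [sub_sub_sub_cancel_right] at this
      exact le_trans (by linarith) (le_abs_self _)
  have e : ‖Y - b‖ ^ 2 / n - σhat ^ 2 = (‖Y - b‖ ^ 2 - n * σhat ^ 2) / n := by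
    field_simp
  rw [e, abs_div, abs_of_pos hn']
  gcongr
end
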